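/- (Result 1, Bob-side.) Assume the QSE conjecture in the form: for every two-qubit state σ with ‖b(σ)‖ < 1, B(σ) ≤ max(√(2(1−‖c_A(σ)‖)), 1). Let ρ be a two-qubit state with ‖b(ρ)‖ < 1 and ‖c_A(ρ)‖ > 1/2. Then for every invertible 2×2 complex matrix f_B such that ‖b(ρ'_FB)‖ < 1, the Bob-filtered state satisfies B(ρ'_FB) ≤ 1; that is, Bob alone cannot reveal any hidden CHSH-inequality violation of ρ. -/

import Mathlib

open Matrix Kronecker Complex
open scoped ComplexOrder

noncomputable section

/-- 2×2 complex matrices (one qubit operators). -/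
abbrev Mat2 := Matrix (Fin 2) (Fin 2) ℂ
/-- 4×4 complex matrices, indexed by ℂ²⊗ℂ² product indices (two qubit operators). -/
abbrev Mat4 := Matrix (Fin 2 × Fin 2) (Fin 2 × Fin 2) ℂ

/-- A two-qubit state: positive semidefinite with trace 1. -/
def IsState (ρ : Mat4) : Prop := ρ.PosSemidef ∧ ρ.trace = 1

/-- The Pauli matrices σ₁, σ₂, σ₃ (indexed by 0,1,2). -/
def pauli : Fin 3 → Mat2 :=
  ![!![0, 1; 1, 0], !![0, -Complex.I; Complex.I, 0], !![1, 0; 0, -1]]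

/-- Alice's Bloch vector: a_i = tr((σ_i ⊗ 𝟙)ρ). -/
def aVec (ρ : Mat4) : Fin 3 → ℝ := fun i => ((pauli i ⊗ₖ (1 : Mat2)) * ρ).trace.re
/-- Bob's Bloch vector: b_i = tr((𝟙 ⊗ σ_i)ρ). -/
def bVec (ρ : Mat4) : Fin 3 → ℝ := fun i => (((1 : Mat2) ⊗ₖ pauli i) * ρ).trace.re
/-- Correlation matrix: T_{ij} = tr((σ_i ⊗ σ_j)ρ). -/
def Tmat (ρ : Mat4) : Matrix (Fin 3) (Fin 3) ℝ :=
  Matrix.of fun i j => ((pauli i ⊗ₖ pauli j) * ρ).trace.re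

/-- Euclidean norm on ℝ³. -/
def norm3 (v : Fin 3 → ℝ) : ℝ := Real.sqrt (∑ i, v i ^ 2)

/-- Alice's quantum steering ellipsoid centre c_A = γ_b²(a − T b), γ_b² = 1/(1 − ‖b‖²). -/
def cA (ρ : Mat4) : Fin 3 → ℝ :=
  (1 - norm3 (bVec ρ) ^ 2)⁻¹ • (aVec ρ - Tmat ρ *ᵥ bVec ρ)
/-- Bob's quantum steering ellipsoid centre c_B = γ_a²(b − Tᵀ a), γ_a² = 1/(1 − ‖a‖²). -/
def cB (ρ : Mat4) : Fin 3 → ℝ :=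
  (1 - norm3 (aVec ρ) ^ 2)⁻¹ • (bVec ρ - (Tmat ρ)ᵀ *ᵥ aVec ρ)

/-- Alice's QSE matrix Q_A = γ_b²(T − a bᵀ)(𝟙₃ + γ_b² b bᵀ)(Tᵀ − b aᵀ). -/
def QA (ρ : Mat4) : Matrix (Fin 3) (Fin 3) ℝ :=
  (1 - norm3 (bVec ρ) ^ 2)⁻¹ •
    ((Tmat ρ - vecMulVec (aVec ρ) (bVec ρ)) *
      (1 + (1 - norm3 (bVec ρ) ^ 2)⁻¹ • vecMulVec (bVec ρ) (bVec ρ)) *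
      ((Tmat ρ)ᵀ - vecMulVec (bVec ρ) (aVec ρ)))

/-- Bob's QSE matrix Q_B = γ_a²(Tᵀ − b aᵀ)(𝟙₃ + γ_a² a aᵀ)(T − a bᵀ). -/
def QB (ρ : Mat4) : Matrix (Fin 3) (Fin 3) ℝ :=
  (1 - norm3 (aVec ρ) ^ 2)⁻¹ •
    (((Tmat ρ)ᵀ - vecMulVec (bVec ρ) (aVec ρ)) *
      (1 + (1 - norm3 (aVec ρ) ^ 2)⁻¹ • vecMulVec (aVec ρ) (aVec ρ)) *
      (Tmat ρ - vecMulVec (aVec ρ) (bVec ρ)))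

/-- The Alice-filtered state ρ'_FA = (f⊗𝟙)ρ(f⊗𝟙)† / tr[(f†f⊗𝟙)ρ]. -/
def filterA (ρ : Mat4) (f : Mat2) : Mat4 :=
  ((((fᴴ * f) ⊗ₖ (1 : Mat2)) * ρ).trace)⁻¹ • ((f ⊗ₖ (1 : Mat2)) * ρ * (f ⊗ₖ (1 : Mat2))ᴴ)

/-- The Bob-filtered state ρ'_FB = (𝟙⊗f)ρ(𝟙⊗f)† / tr[(𝟙⊗f†f)ρ]. -/
def filterB (ρ : Mat4) (f : Mat2) : Mat4 :=
  ((((1 : Mat2) ⊗ₖ (fᴴ * f)) * ρ).trace)⁻¹ • (((1 : Mat2) ⊗ₖ f) * ρ * ((1 : Mat2) ⊗ₖ f)ᴴ)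

/-- The two-sided filtered state (f_A⊗f_B)ρ(f_A⊗f_B)† / tr[(f_A†f_A ⊗ f_B†f_B)ρ]. -/
def filterAB (ρ : Mat4) (f g : Mat2) : Mat4 :=
  ((((fᴴ * f) ⊗ₖ (gᴴ * g)) * ρ).trace)⁻¹ • ((f ⊗ₖ g) * ρ * (f ⊗ₖ g)ᴴ)

/-- The qubit observable α·σ for α ∈ ℝ³. -/
def obs (α : Fin 3 → ℝ) : Mat2 := ∑ k, (α k : ℂ) • pauli k

/-- The expectation value ⟨A⊗B⟩_ρ = tr((A⊗B)ρ) (real for states/Hermitian observables). -/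
def expVal (ρ : Mat4) (A B : Mat2) : ℝ := ((A ⊗ₖ B) * ρ).trace.re

/-- The CHSH functional ½(⟨A¹B¹⟩+⟨A¹B²⟩+⟨A²B¹⟩−⟨A²B²⟩). -/
def chshVal (ρ : Mat4) (α1 α2 β1 β2 : Fin 3 → ℝ) : ℝ :=
  (expVal ρ (obs α1) (obs β1) + expVal ρ (obs α1) (obs β2)
    + expVal ρ (obs α2) (obs β1) - expVal ρ (obs α2) (obs β2)) / 2

/-- The maximal CHSH value B(ρ) over measurement directions (unit vectors in ℝ³). -/
def Bval (ρ : Mat4) : ℝ :=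
  sSup {x | ∃ α1 α2 β1 β2 : Fin 3 → ℝ, norm3 α1 = 1 ∧ norm3 α2 = 1 ∧
    norm3 β1 = 1 ∧ norm3 β2 = 1 ∧ x = chshVal ρ α1 α2 β1 β2}

/-- The F₃ functional (1/√3)Σᵢ tr((Aⁱ⊗σᵢ)ρ). -/
def f3Val (ρ : Mat4) (α : Fin 3 → Fin 3 → ℝ) : ℝ :=
  (∑ i, expVal ρ (obs (α i)) (pauli i)) / Real.sqrt 3

/-- The maximal F₃ value over measurement directions. -/
def F3val (ρ : Mat4) : ℝ :=
  sSup {x | ∃ α : Fin 3 → Fin 3 → ℝ, (∀ i, norm3 (α i) = 1) ∧ x = f3Val ρ α}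

/-- Partial trace over Bob (second factor). -/
def trB (M : Mat4) : Mat2 := Matrix.of fun i j => ∑ k, M (i, k) (j, k)
/-- Partial trace over Alice (first factor). -/
def trA (M : Mat4) : Mat2 := Matrix.of fun i j => ∑ k, M (k, i) (k, j)

/-- The vector |φ⁺(θ)⟩ = cosθ|00⟩ + sinθ|11⟩. -/
def phiVec (θ : ℝ) : Fin 2 × Fin 2 → ℂ :=
  fun q => if q = (0, 0) then (Real.cos θ : ℂ) else if q = (1, 1) then (Real.sin θ : ℂ) else 0

/-- The projector φ⁺(θ) = |φ⁺(θ)⟩⟨φ⁺(θ)|. -/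
def phiProj (θ : ℝ) : Mat4 := vecMulVec (phiVec θ) (star (phiVec θ))

/-- ρ_A(θ) = tr_B φ⁺(θ) = diag(cos²θ, sin²θ). -/
def rhoA (θ : ℝ) : Mat2 := !![(Real.cos θ : ℂ) ^ 2, 0; 0, (Real.sin θ : ℂ) ^ 2]

/-- Partially entangled state with one-sided coloured noise. -/
def rhoM (θ p : ℝ) : Mat4 :=
  (p : ℂ) • phiProj θ + ((1 - p : ℝ) : ℂ) • (rhoA θ ⊗ₖ ((1 / 2 : ℂ) • (1 : Mat2)))

/-- Partially entangled state with symmetric coloured noise. -/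
def rhoMM (θ p : ℝ) : Mat4 :=
  (p : ℂ) • phiProj θ + ((1 - p : ℝ) : ℂ) • (rhoA θ ⊗ₖ rhoA θ)

/-- The vector |Φ⁺⟩ = (|00⟩+|11⟩)/√2. -/
def maxEntVec : Fin 2 × Fin 2 → ℂ :=
  fun q => if q.1 = q.2 then ((Real.sqrt 2 : ℂ))⁻¹ else 0

/-- The projector Φ⁺ = |Φ⁺⟩⟨Φ⁺|. -/
def maxEntProj : Mat4 := vecMulVec maxEntVec (star maxEntVec)

/-- The singlet vector |Ψ⁻⟩ = (|01⟩−|10⟩)/√2. -/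
def singletVec : Fin 2 × Fin 2 → ℂ :=
  fun q => if q = (0, 1) then ((Real.sqrt 2 : ℂ))⁻¹
    else if q = (1, 0) then -((Real.sqrt 2 : ℂ))⁻¹ else 0

/-- The singlet projector |Ψ⁻⟩⟨Ψ⁻|. -/
def singletProj : Mat4 := vecMulVec singletVec (star singletVec)

/-- The vector |00⟩. -/
def zeroVec : Fin 2 × Fin 2 → ℂ := fun q => if q = (0, 0) then 1 else 0

/-- The quasi-distillable state ρ_QD(p) = p|Ψ⁻⟩⟨Ψ⁻| + (1−p)|00⟩⟨00|. -/
def rhoQD (p : ℝ) : Mat4 :=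
  (p : ℂ) • singletProj + ((1 - p : ℝ) : ℂ) • vecMulVec zeroVec (star zeroVec)

theorem trace_trA (M : Mat4) : (trA M).trace = M.trace := by
  simp only [trA, Matrix.trace, Matrix.diag, Matrix.of_apply, Fintype.sum_prod_type]
  exact Finset.sum_comm

theorem trA_one_kronecker_mul (f : Mat2) (M : Mat4) :
    trA (((1 : Mat2) ⊗ₖ f) * M) = f * trA M := by
  ext i j
  simp [trA, Matrix.mul_apply, Fintype.sum_prod_type, Fin.sum_univ_two, Matrix.one_apply]
  ring

theorem trA_mul_one_kronecker (f : Mat2) (M : Mat4) :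
    trA (M * ((1 : Mat2) ⊗ₖ f)) = trA M * f := by
  ext i j
  simp [trA, Matrix.mul_apply, Fintype.sum_prod_type, Fin.sum_univ_two, Matrix.one_apply]
  ring

theorem trA_smul (c : ℂ) (M : Mat4) : trA (c • M) = c • trA M := by
  ext i j
  simp [trA, mul_add]

/-- Bob's unnormalised conditional operator `tr_A ((A ⊗ 𝟙) M)`. -/
def condOp (A : Mat2) (M : Mat4) : Mat2 := trA ((A ⊗ₖ (1 : Mat2)) * M)

theorem trace_kronecker_mul (A B : Mat2) (M : Mat4) :
    ((A ⊗ₖ B) * M).trace = (B * condOp A M).trace := by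
  rw [condOp, ← trA_one_kronecker_mul, trace_trA, ← Matrix.mul_assoc, ← Matrix.mul_kronecker_mul,
    Matrix.one_mul, Matrix.mul_one]

theorem condOp_filterB (A f : Mat2) (ρ : Mat4) :
    condOp A (filterB ρ f) =
      ((((1 : Mat2) ⊗ₖ (fᴴ * f)) * ρ).trace)⁻¹ • (f * condOp A ρ * fᴴ) := by
  have hcomm : (A ⊗ₖ (1 : Mat2)) * ((1 : Mat2) ⊗ₖ f) = ((1 : Mat2) ⊗ₖ f) * (A ⊗ₖ (1 : Mat2)) := by
    simp [← Matrix.mul_kronecker_mul]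
  rw [condOp, condOp, filterB, Matrix.mul_smul, trA_smul, ← trA_one_kronecker_mul,
    ← trA_mul_one_kronecker, Matrix.conjTranspose_kronecker, Matrix.conjTranspose_one,
    ← Matrix.mul_assoc, ← Matrix.mul_assoc, ← Matrix.mul_assoc, hcomm]

theorem trace_mul_adjugate_eq_pauli (X Y : Mat2) :
    X.trace * Y.trace - ∑ j, (pauli j * X).trace * (pauli j * Y).trace =
      2 * (X * Y.adjugate).trace := by
  simp [pauli, Fin.sum_univ_three, Matrix.trace_fin_two, Matrix.mul_apply, Fin.sum_univ_two,
    Matrix.adjugate_fin_two]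
  ring_nf
  simp only [Complex.I_sq]
  ring

theorem trace_conj_mul_adjugate_conj (c : ℂ) (f X Y : Mat2) :
    ((c • (f * X * fᴴ)) * (c • (f * Y * fᴴ)).adjugate).trace =
      c ^ 2 * (f.det * fᴴ.det) * (X * Y.adjugate).trace := by
  have h : f * X * fᴴ * (fᴴ.adjugate * (Y.adjugate * f.adjugate)) =
      fᴴ.det • (f * (X * Y.adjugate) * f.adjugate) := by
    calc _ = f * X * (fᴴ * fᴴ.adjugate) * (Y.adjugate * f.adjugate) := by
          simp only [Matrix.mul_assoc]
      _ = _ := by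
          rw [Matrix.mul_adjugate]
          simp [Matrix.mul_assoc]
  rw [Matrix.adjugate_smul, Matrix.adjugate_mul_distrib, Matrix.adjugate_mul_distrib,
    Matrix.smul_mul, Matrix.mul_smul, h, smul_smul, smul_smul, Matrix.trace_smul,
    Matrix.trace_mul_comm, ← Matrix.mul_assoc, Matrix.adjugate_mul]
  simp
  ring

theorem pauli_isHermitian (i : Fin 3) : (pauli i).IsHermitian := by
  fin_cases i <;> ext a b <;> fin_cases a <;> fin_cases b <;> simp [pauli]

theorem ofReal_re_trace_mul {n : Type*} [Fintype n] {A B : Matrix n n ℂ}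
    (hA : A.IsHermitian) (hB : B.IsHermitian) : (((A * B).trace.re : ℝ) : ℂ) = (A * B).trace := by
  rw [← Complex.conj_eq_iff_re, starRingEnd_apply, ← Matrix.trace_conjTranspose,
    Matrix.conjTranspose_mul, hA.eq, hB.eq, Matrix.trace_mul_comm]

theorem isHermitian_kronecker {A B : Mat2} (hA : A.IsHermitian) (hB : B.IsHermitian) :
    (A ⊗ₖ B).IsHermitian := by
  rw [Matrix.IsHermitian, Matrix.conjTranspose_kronecker, hA.eq, hB.eq]

theorem ofReal_re_trace_kronecker_mul {A B : Mat2} {ρ : Mat4} (hA : A.IsHermitian)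
    (hB : B.IsHermitian) (hρ : ρ.IsHermitian) :
    ((((A ⊗ₖ B) * ρ).trace.re : ℝ) : ℂ) = (B * condOp A ρ).trace := by
  rw [ofReal_re_trace_mul (isHermitian_kronecker hA hB) hρ, trace_kronecker_mul]

theorem ofReal_cA {ρ : Mat4} (hρ : ρ.IsHermitian) (htr : ρ.trace = 1) (i : Fin 3) :
    (cA ρ i : ℂ) = (condOp (pauli i) ρ * (condOp 1 ρ).adjugate).trace /
      (condOp 1 ρ * (condOp 1 ρ).adjugate).trace := by
  have h1 : (1 : Mat2).IsHermitian := Matrix.isHermitian_one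
  have ha : (aVec ρ i : ℂ) = (condOp (pauli i) ρ).trace := by
    rw [aVec, ofReal_re_trace_kronecker_mul (pauli_isHermitian i) h1 hρ, Matrix.one_mul]
  have hb (j : Fin 3) : (bVec ρ j : ℂ) = (pauli j * condOp 1 ρ).trace :=
    ofReal_re_trace_kronecker_mul h1 (pauli_isHermitian j) hρ
  have hT (j : Fin 3) : (Tmat ρ i j : ℂ) = (pauli j * condOp (pauli i) ρ).trace :=
    ofReal_re_trace_kronecker_mul (pauli_isHermitian i) (pauli_isHermitian j) hρ
  have hone : (condOp 1 ρ).trace = 1 := by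
    rw [condOp, trace_trA, Matrix.one_kronecker_one, Matrix.one_mul, htr]
  have hnum : ((aVec ρ i - ∑ j, Tmat ρ i j * bVec ρ j : ℝ) : ℂ) =
      2 * (condOp (pauli i) ρ * (condOp 1 ρ).adjugate).trace := by
    rw [← trace_mul_adjugate_eq_pauli, hone]
    push_cast
    simp only [ha, hb, hT, mul_one]
  have hden : ((1 - norm3 (bVec ρ) ^ 2 : ℝ) : ℂ) =
      2 * (condOp 1 ρ * (condOp 1 ρ).adjugate).trace := by
    rw [← trace_mul_adjugate_eq_pauli, hone, norm3,
      Real.sq_sqrt (Finset.sum_nonneg fun _ _ => sq_nonneg _)]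
    push_cast
    simp only [hb, mul_one, sq]
  have hc : cA ρ i = (aVec ρ i - ∑ j, Tmat ρ i j * bVec ρ j) / (1 - norm3 (bVec ρ) ^ 2) := by
    simp [cA, Matrix.mulVec, dotProduct, div_eq_inv_mul]
  rw [hc, Complex.ofReal_div, hnum, hden, mul_div_mul_left _ _ two_ne_zero]

theorem trace_one_kronecker_conj (ρ : Mat4) (f : Mat2) :
    (((1 : Mat2) ⊗ₖ f) * ρ * ((1 : Mat2) ⊗ₖ f)ᴴ).trace =
      (((1 : Mat2) ⊗ₖ (fᴴ * f)) * ρ).trace := by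
  rw [Matrix.trace_mul_comm, ← Matrix.mul_assoc, Matrix.conjTranspose_kronecker,
    ← Matrix.mul_kronecker_mul, Matrix.conjTranspose_one, Matrix.one_mul]

theorem filterB_trace_ne_zero {ρ : Mat4} (hρ : IsState ρ) {f : Mat2} (hf : IsUnit f) :
    (((1 : Mat2) ⊗ₖ (fᴴ * f)) * ρ).trace ≠ 0 := by
  rw [← trace_one_kronecker_conj]
  have hu : IsUnit ((1 : Mat2) ⊗ₖ f) := by
    rw [Matrix.isUnit_iff_isUnit_det, Matrix.det_kronecker]
    simpa using ((Matrix.isUnit_iff_isUnit_det f).1 hf).ne_zero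
  have hu' : IsUnit ((1 : Mat2) ⊗ₖ f)ᴴ := hu.star
  intro h
  rw [(hρ.1.mul_mul_conjTranspose_same _).trace_eq_zero_iff, hu'.mul_left_eq_zero,
    hu.mul_right_eq_zero] at h
  simpa [h] using hρ.2

theorem isState_filterB {ρ : Mat4} (hρ : IsState ρ) {f : Mat2} (hf : IsUnit f) :
    IsState (filterB ρ f) := by
  have hM := hρ.1.mul_mul_conjTranspose_same ((1 : Mat2) ⊗ₖ f)
  refine ⟨hM.smul ?_, ?_⟩
  · rw [← trace_one_kronecker_conj]
    exact inv_nonneg.2 hM.trace_nonneg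
  · rw [filterB, Matrix.trace_smul, trace_one_kronecker_conj, smul_eq_mul,
      inv_mul_cancel₀ (filterB_trace_ne_zero hρ hf)]

/-- The centre of Alice's steering ellipsoid is invariant under Bob's local filtering. -/
theorem cA_filterB {ρ : Mat4} (hρ : IsState ρ) {f : Mat2} (hf : IsUnit f) :
    cA (filterB ρ f) = cA ρ := by
  have hσ := isState_filterB hρ hf
  have hdet : f.det ≠ 0 := ((Matrix.isUnit_iff_isUnit_det f).1 hf).ne_zero
  have hdet' : fᴴ.det ≠ 0 := by simpa [Matrix.det_conjTranspose] using hdet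
  funext i
  apply Complex.ofReal_injective
  rw [ofReal_cA hσ.1.isHermitian hσ.2, ofReal_cA hρ.1.isHermitian hρ.2]
  simp only [condOp_filterB, trace_conj_mul_adjugate_conj]
  exact mul_div_mul_left _ _ (mul_ne_zero
    (pow_ne_zero 2 (inv_ne_zero (filterB_trace_ne_zero hρ hf))) (mul_ne_zero hdet hdet'))

/-- Result 1, Bob-side: assuming the QSE conjecture, if ‖c_A(ρ)‖ > 1/2 then
Bob alone cannot reveal any hidden CHSH-inequality violation. -/
theorem stmt_3
    (conj : ∀ σ : Mat4, IsState σ → norm3 (bVec σ) < 1 →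
      Bval σ ≤ max (Real.sqrt (2 * (1 - norm3 (cA σ)))) 1)
    (ρ : Mat4) (hρ : IsState ρ) (hb : norm3 (bVec ρ) < 1)
    (hc : 1 / 2 < norm3 (cA ρ)) :
    ∀ fB : Mat2, IsUnit fB → norm3 (bVec (filterB ρ fB)) < 1 →
      Bval (filterB ρ fB) ≤ 1 := by
  intro fB hf hb'
  refine (conj _ (isState_filterB hρ hf) hb').trans ?_
  rw [cA_filterB hρ hf]
  refine max_le (Real.sqrt_le_one.2 ?_) le_rfl
  linarith

end
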